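/- arXiv:0906.3749 — 2 statements merged into one kernel-verified Lean document; each statement's English description precedes it below -/
import Mathlib

section
/- The 6-state 2-symbol Turing machine M with transition table δ(A,0)=(1,R,B), δ(A,1)=(1,R,A), δ(B,0)=(1,L,C), δ(B,1)=(1,L,B), δ(C,0)=(0,R,F), δ(C,1)=(1,L,D), δ(D,0)=(1,R,A), δ(D,1)=(0,L,E), δ(E,0)=(1,R,H), δ(E,1)=(1,L,F), δ(F,0)=(0,L,A), δ(F,1)=(0,L,C), started in state A on the all-blank tape, halts after exactly 8,690,333,381,690,951 steps leaving exactly 95,524,079 non-blank cells on the tape. -/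
/-- Move direction of the tape head. -/
inductive Dir : Type
  | L
  | R

/-- The head displacement of a direction. -/
def Dir.move : Dir → ℤ
  | Dir.L => -1
  | Dir.R => 1

/-- A Turing machine with `n` states and `k` symbols, in Rado's busy beaver model.
States are `Fin n` (state `A` is `0`, `B` is `1`, ...), symbols are `Fin k` with `0`
the blank symbol. A transition yields the written symbol, the move direction and the
next state, where `none` denotes the halting state `H`. -/
abbrev Machine (n k : ℕ) : Type :=
  Fin n → Fin k → Fin k × Dir × Option (Fin n)

/-- A configuration: current state (`none` = halted), head position, tape. -/
structure Cfg (n k : ℕ) where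
  state : Option (Fin n)
  pos : ℤ
  tape : ℤ → Fin k

/-- One computation step (halted configurations are fixed). -/
def step {n k : ℕ} (M : Machine n k) (c : Cfg n k) : Cfg n k :=
  match c.state with
  | none => c
  | some q =>
      { state := (M q (c.tape c.pos)).2.2
        pos := c.pos + (M q (c.tape c.pos)).2.1.move
        tape := Function.update c.tape c.pos (M q (c.tape c.pos)).1 }

/-- The initial configuration: state `A`, head at cell `0`, all-blank tape. -/
def init (n k : ℕ) [NeZero k] : Cfg n k :=
  { state := if h : 0 < n then some ⟨0, h⟩ else none
    pos := 0
    tape := fun _ => 0 }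

/-- `HaltsIn M c t`: started from `c`, the machine `M` halts after exactly `t` steps. -/
def HaltsIn {n k : ℕ} (M : Machine n k) (c : Cfg n k) (t : ℕ) : Prop :=
  ((step M)^[t] c).state = none ∧ ∀ i < t, ((step M)^[i] c).state ≠ none

/-- The number of non-blank cells of a configuration. -/
noncomputable def sigmaCount {n k : ℕ} [NeZero k] (c : Cfg n k) : ℕ :=
  Set.ncard {i : ℤ | c.tape i ≠ 0}

/-- Marxen and Buntrock's 6-state 2-symbol machine of 1997
(states `A,B,C,D,E,F` are `0,1,2,3,4,5`; `none` is the halting state `H`). -/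
def M : Machine 6 2 :=
  ![![(1, Dir.R, some 1), (1, Dir.R, some 0)],
    ![(1, Dir.L, some 2), (1, Dir.L, some 1)],
    ![(0, Dir.R, some 5), (1, Dir.L, some 3)],
    ![(1, Dir.R, some 0), (0, Dir.L, some 4)],
    ![(1, Dir.R, none), (1, Dir.L, some 5)],
    ![(0, Dir.L, some 0), (0, Dir.L, some 2)]]

/-- `Run t c d`: the machine goes from `c` to `d` in exactly `t` steps. -/
def Run (t : ℕ) (c d : Cfg 6 2) : Prop :=
  (step M)^[t] c = d

theorem Run.trans {s t : ℕ} {c d e : Cfg 6 2} (h₁ : Run s c d) (h₂ : Run t d e) :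
    Run (s + t) c e := by
  rw [Run, Nat.add_comm, Function.iterate_add_apply, h₁, h₂]

theorem Run.congr {t t' : ℕ} {c : Cfg 6 2} {q q' : Option (Fin 6)} {p p' : ℤ} {T T' : ℤ → Fin 2}
    (h : Run t c ⟨q, p, T⟩) (ht : t = t') (hq : q = q') (hp : p = p') (hT : ∀ i, T i = T' i) :
    Run t' c ⟨q', p', T'⟩ := by
  obtain rfl : T = T' := funext hT
  subst ht hq hp
  exact h

theorem run_one_left {q : Fin 6} (s : Fin 2) {w : Fin 2} {q' : Option (Fin 6)} {p : ℤ}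
    {T : ℤ → Fin 2} (hM : M q s = (w, Dir.L, q')) (h : T p = s) :
    Run 1 ⟨some q, p, T⟩ ⟨q', p - 1, fun i => if i = p then w else T i⟩ := by
  subst h
  simp only [Run, Function.iterate_one, step, hM, Cfg.mk.injEq, Dir.move, true_and]
  exact ⟨rfl, funext fun i => Function.update_apply ..⟩

theorem run_one_right {q : Fin 6} (s : Fin 2) {w : Fin 2} {q' : Option (Fin 6)} {p : ℤ}
    {T : ℤ → Fin 2} (hM : M q s = (w, Dir.R, q')) (h : T p = s) :
    Run 1 ⟨some q, p, T⟩ ⟨q', p + 1, fun i => if i = p then w else T i⟩ := by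
  subst h
  simp only [Run, Function.iterate_one, step, hM, Cfg.mk.injEq, Dir.move, true_and]
  exact funext fun i => Function.update_apply ..

/-- State `A` runs right over a block of ones. -/
theorem run_right (T : ℤ → Fin 2) (m : ℕ) (p : ℤ) (h : ∀ i, p ≤ i → i < p + m → T i = 1) :
    Run m ⟨some 0, p, T⟩ ⟨some 0, p + m, T⟩ := by
  induction m with
  | zero => simp [Run]
  | succ m ih =>
    have h₁ := ih fun i hi hi' => h i hi (by push_cast; omega)
    have hs : T (p + m) = 1 := h _ (by omega) (by push_cast; omega)
    refine (h₁.trans (run_one_right 1 rfl hs)).congr rfl rfl (by push_cast; ring) fun i => ?_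
    split_ifs with hi
    · rw [hi, hs]
    · rfl

/-- State `B` runs left over a block of ones. -/
theorem run_left (T : ℤ → Fin 2) (m : ℕ) (p : ℤ) (h : ∀ i, p - m < i → i ≤ p → T i = 1) :
    Run m ⟨some 1, p, T⟩ ⟨some 1, p - m, T⟩ := by
  induction m with
  | zero => simp [Run]
  | succ m ih =>
    have h₁ := ih fun i hi hi' => h i (by push_cast; omega) hi'
    have hs : T (p - m) = 1 := h _ (by push_cast; omega) (by omega)
    refine (h₁.trans (run_one_left 1 rfl hs)).congr rfl rfl (by push_cast; ring) fun i => ?_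
    split_ifs with hi
    · rw [hi, hs]
    · rfl

/-- The cycle `C → D → E → F → C` runs left over a block of ones, erasing every other one. -/
theorem run_alternate (T : ℤ → Fin 2) (m : ℕ) (p : ℤ)
    (h : ∀ i, p - 4 * m < i → i ≤ p → T i = 1) :
    Run (4 * m) ⟨some 2, p, T⟩ ⟨some 2, p - 4 * m,
      fun i => if p - 4 * m < i ∧ i ≤ p ∧ (p - i) % 2 = 1 then 0 else T i⟩ := by
  induction m with
  | zero =>
    refine Run.congr (t := 0) rfl rfl rfl (by simp) fun i => ?_
    rw [if_neg (by push_cast; omega)]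
  | succ m ih =>
    have h₁ := ih fun i hi hi' => h i (by push_cast; omega) hi'
    push_cast at h
    have h₂ := h₁.trans <| (run_one_left 1 rfl ?_).trans <| (run_one_left 1 rfl ?_).trans <|
      (run_one_left 1 rfl ?_).trans (run_one_left 1 rfl ?_)
    · refine h₂.congr (by ring) rfl (by push_cast; ring) fun i => ?_
      have hi := h i
      push_cast
      split_ifs <;> first | rfl | (exfalso; omega) | (rw [hi] <;> omega)
    all_goals
      repeat rw [if_neg (by omega)]
      exact h _ (by omega) (by omega)

/-- State `C` on a blank cell followed by another blank turns both into ones. -/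
theorem run_fill (T : ℤ → Fin 2) (p : ℤ) (h₀ : T p = 0) (h₁ : T (p + 1) = 0) :
    Run 5 ⟨some 2, p, T⟩
      ⟨some 3, p - 1, fun i => if i = p ∨ i = p + 1 then 1 else T i⟩ := by
  have h := (run_one_right (q := 2) (p := p) (T := T) 0 rfl ?_).trans <|
    (run_one_left 0 rfl ?_).trans <| (run_one_right 0 rfl ?_).trans <|
    (run_one_left 0 rfl ?_).trans (run_one_left 1 rfl ?_)
  · refine h.congr rfl rfl (by ring) fun i => ?_
    split_ifs <;> first | rfl | (exfalso; omega)
  all_goals simp [h₀, h₁]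

/-- State `B` at the left end of the written tape extends it by two ones. -/
theorem run_extend (T : ℤ → Fin 2) (p : ℤ) (h₀ : T p = 0) (h₁ : T (p - 1) = 0) :
    Run 8 ⟨some 1, p, T⟩
      ⟨some 3, p - 2, fun i => if i = p - 1 ∨ i = p then 1 else T i⟩ := by
  have h := (run_one_left (q := 1) (p := p) (T := T) 0 rfl ?_).trans <|
    (run_one_right 0 rfl ?_).trans <| (run_one_left 1 rfl ?_).trans (run_fill _ _ ?_ ?_)
  · refine h.congr rfl rfl (by ring) fun i => ?_
    split_ifs <;> first | rfl | (exfalso; omega)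
  all_goals simp [h₀, h₁] <;> omega

/-- State `A` just to the right of the block of ones on `[p, p + n)`, on a blank tape. -/
def solid (p : ℤ) (n : ℕ) : Cfg 6 2 :=
  ⟨some 0, p + n, fun i => if p ≤ i ∧ i < p + n then 1 else 0⟩

/-- State `D` just to the left of the word `1 ^ a (01) ^ k 1`, on a blank tape. -/
def mixed (p : ℤ) (a k : ℕ) : Cfg 6 2 :=
  ⟨some 3, p, fun i => if p < i ∧ i ≤ p + a ∨ p + a < i ∧ i ≤ p + a + 2 * k ∧ (i - p - a) % 2 = 0 ∨
    i = p + a + 2 * k + 1 then 1 else 0⟩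

theorem mixed_zero (p : ℤ) (a : ℕ) : Run (a + 2) (mixed p a 0) (solid p (a + 2)) := by
  have h := (run_one_right (q := 3) (p := p) (T := (mixed p a 0).tape) 0 rfl ?_).trans
    (run_right _ (a + 1) (p + 1) ?_)
  · refine h.congr (by ring) rfl (by push_cast; ring) fun i => ?_
    simp only [mixed]
    split_ifs <;> first | rfl | (exfalso; omega)
  all_goals
    intros
    simp only [mixed]
    split_ifs <;> first | rfl | (exfalso; omega)

theorem mixed_succ (p : ℤ) (a k : ℕ) :
    Run (2 * a + 13) (mixed p a (k + 1)) (mixed (p - 3) (a + 5) k) := by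
  have h := (run_one_right (q := 3) (p := p) (T := (mixed p a (k + 1)).tape) 0 rfl ?_).trans <|
    (run_right _ a (p + 1) ?_).trans <| (run_one_right 0 rfl ?_).trans <|
    (run_left _ (a + 3) (p + 1 + a + 1) ?_).trans (run_extend _ _ ?_ ?_)
  · refine h.congr (by ring) rfl (by push_cast; ring) fun i => ?_
    simp only [mixed]
    split_ifs <;> first | rfl | (exfalso; omega)
  all_goals
    intros
    simp only [mixed]
    split_ifs <;> first | rfl | (exfalso; omega)

theorem mixed_to_solid (k : ℕ) : ∀ (p : ℤ) (a : ℕ), ∃ q,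
    Run (5 * k ^ 2 + 2 * a * k + 13 * k + a + 2) (mixed p a k) (solid q (a + 5 * k + 2)) := by
  induction k with
  | zero => exact fun p a => ⟨p, (by simpa using mixed_zero p a)⟩
  | succ k ih =>
    intro p a
    obtain ⟨q, hq⟩ := ih (p - 3) (a + 5)
    refine ⟨q, ?_⟩
    convert (mixed_succ p a k).trans hq using 1
    · ring
    · congr 1; ring

/-- After `4 * j + 2` steps, all but the leftmost `r + 1` ones of a block are alternated. -/
theorem solid_alternate (p : ℤ) (j r : ℕ) :
    Run (4 * j + 2) (solid p (4 * j + r)) ⟨some 2, p + r, fun i =>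
      if p ≤ i ∧ i ≤ p + r ∨ p + r < i ∧ i ≤ p + r + 4 * j ∧ (i - p - r) % 2 = 0 ∨
        i = p + r + 4 * j + 1 then 1 else 0⟩ := by
  have h := (run_one_right (q := 0) (p := p + ((4 * j + r : ℕ) : ℤ))
    (T := (solid p (4 * j + r)).tape) 0 rfl ?_).trans <|
    (run_one_left 0 rfl ?_).trans (run_alternate _ j _ ?_)
  · refine h.congr (by ring) rfl (by push_cast; ring) fun i => ?_
    simp only [solid]
    split_ifs <;> first | rfl | (exfalso; omega)
  all_goals
    intros
    simp only [solid]
    split_ifs <;> first | rfl | (exfalso; omega)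

theorem solid_to_mixed_of_mod_zero (p : ℤ) (j : ℕ) :
    Run (4 * j + 3) (solid p (4 * j)) (mixed (p - 1) 1 (2 * j)) := by
  have h := (solid_alternate p j 0).trans (run_one_left 1 rfl ?_)
  · refine h.congr (by ring) rfl (by push_cast; ring) fun i => ?_
    split_ifs <;> first | rfl | (exfalso; omega)
  · split_ifs <;> first | rfl | (exfalso; omega)

theorem solid_to_mixed_of_mod_two (p : ℤ) (j : ℕ) :
    Run (4 * j + 9) (solid p (4 * j + 2)) (mixed (p - 3) 3 (2 * j + 1)) := by
  have h := (solid_alternate p j 2).trans <| (run_one_left 1 rfl ?_).trans <|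
    (run_one_left 1 rfl ?_).trans <| (run_one_left 1 rfl ?_).trans <|
    (run_one_left 0 rfl ?_).trans <| (run_one_right 0 rfl ?_).trans <|
    (run_one_left 0 rfl ?_).trans (run_one_left 1 rfl ?_)
  · refine h.congr (by ring) rfl (by push_cast; ring) fun i => ?_
    split_ifs <;> first | rfl | (exfalso; omega)
  all_goals split_ifs <;> first | rfl | (exfalso; omega)

theorem solid_to_mixed_of_mod_three (p : ℤ) (j : ℕ) :
    Run (4 * j + 11) (solid p (4 * j + 3)) (mixed (p - 2) 3 (2 * j + 1)) := by
  have h := (solid_alternate p j 3).trans <| (run_one_left 1 rfl ?_).trans <|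
    (run_one_left 1 rfl ?_).trans <| (run_one_left 1 rfl ?_).trans <|
    (run_one_left 1 rfl ?_).trans (run_fill _ _ ?_ ?_)
  · refine h.congr (by ring) rfl (by push_cast; ring) fun i => ?_
    split_ifs <;> first | rfl | (exfalso; omega)
  all_goals split_ifs <;> first | rfl | (exfalso; omega)

/-- A block of length `4 * j + 1` halts; the last step is isolated. -/
theorem solid_halt (p : ℤ) (j : ℕ) : ∃ c : Cfg 6 2,
    c.state ≠ none ∧ Run (4 * j + 4) (solid p (4 * j + 1)) c ∧
    Run 1 c ⟨none, p, fun i => if p - 1 ≤ i ∧ i ≤ p + 4 * j + 1 ∧ (i - p) % 2 = 1 ∨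
      i = p + 4 * j + 2 then 1 else 0⟩ := by
  have h := (solid_alternate p j 1).trans <| (run_one_left 1 rfl ?_).trans
    (run_one_left 1 rfl ?_)
  · refine ⟨_, ?_, h, (run_one_right 0 rfl ?_).congr rfl rfl (by push_cast; ring) fun i => ?_⟩
    · simp
    · split_ifs <;> first | rfl | (exfalso; omega)
    · split_ifs <;> first | rfl | (exfalso; omega)
  all_goals split_ifs <;> first | rfl | (exfalso; omega)

/-- Up to translation, a solid block of length `n` becomes one of length `m` in `t` steps. -/
def Grows (t n m : ℕ) : Prop :=
  ∀ p, ∃ q, Run t (solid p n) (solid q m)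

theorem Grows.trans {s t n m l : ℕ} (h₁ : Grows s n m) (h₂ : Grows t m l) :
    Grows (s + t) n l := fun p => by
  obtain ⟨q, hq⟩ := h₁ p
  obtain ⟨r, hr⟩ := h₂ q
  exact ⟨r, hq.trans hr⟩

theorem Run.grows {t n a k : ℕ} {f : ℤ → ℤ} (h : ∀ p, Run t (solid p n) (mixed (f p) a k)) :
    Grows (t + (5 * k ^ 2 + 2 * a * k + 13 * k + a + 2)) n (a + 5 * k + 2) := fun p => by
  obtain ⟨q, hq⟩ := mixed_to_solid k (f p) a
  exact ⟨q, (h p).trans hq⟩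

theorem grows_of_mod_zero (j : ℕ) {n : ℕ} (hn : n = 4 * j) :
    Grows (20 * j ^ 2 + 34 * j + 6) n (10 * j + 3) := by
  subst hn
  convert Run.grows fun p => solid_to_mixed_of_mod_zero p j using 1 <;> ring

theorem grows_of_mod_two (j : ℕ) {n : ℕ} (hn : n = 4 * j + 2) :
    Grows (20 * j ^ 2 + 62 * j + 38) n (10 * j + 10) := by
  subst hn
  convert Run.grows fun p => solid_to_mixed_of_mod_two p j using 1 <;> ring

theorem grows_of_mod_three (j : ℕ) {n : ℕ} (hn : n = 4 * j + 3) :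
    Grows (20 * j ^ 2 + 62 * j + 40) n (10 * j + 10) := by
  subst hn
  convert Run.grows fun p => solid_to_mixed_of_mod_three p j using 1 <;> ring

theorem grows_zero : Grows 8690333190642794 0 191048153 := by
  have h := grows_of_mod_zero 0 rfl
    |>.trans (grows_of_mod_three 0 (by norm_num))
    |>.trans (grows_of_mod_two 2 (by norm_num))
    |>.trans (grows_of_mod_two 7 (by norm_num))
    |>.trans (grows_of_mod_zero 20 (by norm_num))
    |>.trans (grows_of_mod_three 50 (by norm_num))
    |>.trans (grows_of_mod_two 127 (by norm_num))
    |>.trans (grows_of_mod_zero 320 (by norm_num))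
    |>.trans (grows_of_mod_three 800 (by norm_num))
    |>.trans (grows_of_mod_two 2002 (by norm_num))
    |>.trans (grows_of_mod_two 5007 (by norm_num))
    |>.trans (grows_of_mod_zero 12520 (by norm_num))
    |>.trans (grows_of_mod_three 31300 (by norm_num))
    |>.trans (grows_of_mod_two 78252 (by norm_num))
    |>.trans (grows_of_mod_two 195632 (by norm_num))
    |>.trans (grows_of_mod_two 489082 (by norm_num))
    |>.trans (grows_of_mod_two 1222707 (by norm_num))
    |>.trans (grows_of_mod_zero 3056770 (by norm_num))
    |>.trans (grows_of_mod_three 7641925 (by norm_num))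
    |>.trans (grows_of_mod_zero 19104815 (by norm_num))
  simpa using h

theorem haltsIn_of_run {c d e : Cfg 6 2} {t : ℕ} (hd : d.state ≠ none) (he : e.state = none)
    (h₁ : Run t c d) (h₂ : Run 1 d e) : HaltsIn M c (t + 1) := by
  refine ⟨by rw [h₁.trans h₂, he], fun i hi hn => hd ?_⟩
  have hfix : step M ((step M)^[i] c) = (step M)^[i] c := by simp [step, hn]
  rw [← h₁, ← Nat.sub_add_cancel (Nat.lt_succ_iff.mp hi), Function.iterate_add_apply,
    Function.iterate_fixed hfix, hn]

theorem ncard_alternating (p : ℤ) (j : ℕ) :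
    {i : ℤ | p - 1 ≤ i ∧ i ≤ p + 4 * j + 1 ∧ (i - p) % 2 = 1 ∨ i = p + 4 * j + 2}.ncard =
      2 * j + 3 := by
  have h : {i : ℤ | p - 1 ≤ i ∧ i ≤ p + 4 * j + 1 ∧ (i - p) % 2 = 1 ∨ i = p + 4 * j + 2} =
      insert (p + 4 * j + 2)
        (((Finset.range (2 * j + 2)).image fun n : ℕ => p - 1 + 2 * n : Finset ℤ) : Set ℤ) := by
    ext i
    simp only [Set.mem_ofPred_eq, Set.mem_insert_iff, Finset.coe_image, Set.mem_image,
      Finset.coe_range, Set.mem_Iio]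
    constructor
    · rintro (h | h)
      · exact Or.inr ⟨((i - p + 1) / 2).toNat, by omega, by omega⟩
      · exact Or.inl h
    · rintro (h | ⟨n, hn, rfl⟩)
      · exact Or.inr h
      · exact Or.inl (by omega)
  rw [h, ← Finset.coe_insert, Set.ncard_coe_finset, Finset.card_insert_of_notMem,
    Finset.card_image_of_injective, Finset.card_range]
  · intro m n h
    simpa using h
  · simp only [Finset.mem_image, Finset.mem_range, not_exists, not_and]
    omega

/-- Started on the all-blank tape, this machine halts after exactly
8,690,333,381,690,951 steps leaving exactly 95,524,079 non-blank cells. -/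
theorem marxen_buntrock_1997 :
    HaltsIn M (init 6 2) 8690333381690951 ∧
    sigmaCount ((step M)^[8690333381690951] (init 6 2)) = 95524079 := by
  obtain ⟨p, hp⟩ := grows_zero 0
  obtain ⟨c, hc, h₁, h₂⟩ := solid_halt p 47762038
  have hinit : init 6 2 = solid 0 0 := by
    simp only [init, solid, Cfg.mk.injEq]
    refine ⟨rfl, by simp, funext fun i => ?_⟩
    rw [if_neg (by push_cast; omega)]
  have h := hp.trans h₁
  rw [hinit]
  refine ⟨haltsIn_of_run hc rfl h h₂, ?_⟩
  rw [h.trans h₂, sigmaCount]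
  simp only [ne_eq, ite_eq_right_iff, one_ne_zero, imp_false, not_not]
  exact ncard_alternating p 47762038
end

section
/- In Rado's busy beaver model with 2 symbols, for every n ≥ 1 the maximum number of steps satisfies S(n,2) < Σ(3n+6, 2), where Σ(m,2) is the maximum number of non-blank cells left by a halting m-state 2-symbol machine. -/
/-- Rado's condition: every transition into the halting state writes `1` and moves right. -/
def Valid {n k : ℕ} [NeZero k] (M : Machine n k) : Prop :=
  ∀ q a, (M q a).2.2 = none → (M q a).1 = 1 ∧ (M q a).2.1 = Dir.R

/-- The busy beaver step function `S(n,k)`: the maximum number of steps of a halting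
`n`-state `k`-symbol machine started on the all-blank tape. -/
noncomputable def bbS (n k : ℕ) [NeZero k] : ℕ :=
  sSup {t : ℕ | ∃ M : Machine n k, Valid M ∧ HaltsIn M (init n k) t}

/-- The busy beaver score function `Σ(n,k)`: the maximum number of non-blank cells left
by a halting `n`-state `k`-symbol machine started on the all-blank tape. -/
noncomputable def bbSigma (n k : ℕ) [NeZero k] : ℕ :=
  sSup {m : ℕ | ∃ M : Machine n k, Valid M ∧
    ∃ t : ℕ, HaltsIn M (init n k) t ∧ sigmaCount ((step M)^[t] (init n k)) = m}


/-- A two-symbol transition table over an arbitrary type of states. -/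
abbrev Table (Q : Type) : Type := Q → Fin 2 → Fin 2 × Dir × Option Q

/-- `Reaches δ o x τ o' x' τ'`: the table `δ` leads from state `o`, head position `x` and tape `τ`
to state `o'`, head position `x'` and tape `τ'` in finitely many steps. -/
inductive Reaches {Q : Type} (δ : Table Q) :
    Option Q → ℤ → (ℤ → Fin 2) → Option Q → ℤ → (ℤ → Fin 2) → Prop
  | refl (o : Option Q) (x : ℤ) (τ : ℤ → Fin 2) : Reaches δ o x τ o x τ
  | head {q : Q} {x : ℤ} {τ : ℤ → Fin 2} {o' : Option Q} {x' : ℤ} {τ' : ℤ → Fin 2}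
      (h : Reaches δ (δ q (τ x)).2.2 (x + (δ q (τ x)).2.1.move)
        (Function.update τ x (δ q (τ x)).1) o' x' τ') :
      Reaches δ (some q) x τ o' x' τ'

namespace Reaches

variable {Q Q' : Type} {δ : Table Q} {δ' : Table Q'} {o o' o'' : Option Q} {x x' x'' : ℤ}
  {τ τ' τ'' : ℤ → Fin 2}

theorem trans (h : Reaches δ o x τ o' x' τ') (h' : Reaches δ o' x' τ' o'' x'' τ'') :
    Reaches δ o x τ o'' x'' τ'' := by
  induction h with
  | refl => exact h'
  | head _ ih => exact head (ih h')

theorem of_right {q : Q} {a b : Fin 2} (ha : τ x = a) (hδ : δ q a = (b, Dir.R, o)) :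
    Reaches δ (some q) x τ o (x + 1) (Function.update τ x b) := by
  refine head ?_
  rw [ha, hδ]
  exact refl _ _ _

theorem of_left {q : Q} {a b : Fin 2} (ha : τ x = a) (hδ : δ q a = (b, Dir.L, o)) :
    Reaches δ (some q) x τ o (x - 1) (Function.update τ x b) := by
  refine head ?_
  rw [ha, hδ]
  exact refl _ _ _

theorem map (g : Option Q → Option Q')
    (hg : ∀ q, ∃ q', g (some q) = some q' ∧
      ∀ a, δ' q' a = ((δ q a).1, (δ q a).2.1, g (δ q a).2.2))
    (h : Reaches δ o x τ o' x' τ') : Reaches δ' (g o) x τ (g o') x' τ' := by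
  induction h with
  | refl => exact refl _ _ _
  | @head q x τ _ _ _ _ ih =>
    obtain ⟨q', hq, hδ⟩ := hg q
    rw [hq]
    refine head ?_
    rw [hδ]
    exact ih

theorem finite_support (h : Reaches δ o x τ o' x' τ') (hτ : {i | τ i ≠ 0}.Finite) :
    {i | τ' i ≠ 0}.Finite := by
  induction h with
  | refl => exact hτ
  | @head q x τ _ _ _ _ ih =>
    refine ih ((hτ.insert x).subset ?_)
    intro i hi
    by_cases hix : i = x
    · exact Or.inl hix
    · exact Or.inr (by simpa [Function.update_of_ne hix] using hi)

theorem walk_right {q : Q} (hq : δ q 1 = (1, Dir.R, some q)) (k : ℕ) :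
    ∀ x : ℤ, (∀ j, x ≤ j → j < x + k → τ j = 1) →
      Reaches δ (some q) x τ (some q) (x + k) τ := by
  induction k with
  | zero => intro x _; simpa using refl _ _ _
  | succ k ih =>
    intro x hx
    have h1 : τ x = 1 := hx x le_rfl (by push_cast; omega)
    have h2 := of_right h1 hq
    rw [← h1, Function.update_eq_self] at h2
    have h3 := h2.trans (ih (x + 1) fun j h h' => hx j (by omega) (by push_cast; omega))
    convert h3 using 1
    push_cast; ring

theorem walk_left {q : Q} (hq : δ q 1 = (1, Dir.L, some q)) (k : ℕ) :
    ∀ x : ℤ, (∀ j, x - k < j → j ≤ x → τ j = 1) →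
      Reaches δ (some q) x τ (some q) (x - k) τ := by
  induction k with
  | zero => intro x _; simpa using refl _ _ _
  | succ k ih =>
    intro x hx
    have h1 : τ x = 1 := hx x (by push_cast; omega) le_rfl
    have h2 := of_left h1 hq
    rw [← h1, Function.update_eq_self] at h2
    have h3 := h2.trans (ih (x - 1) fun j h h' => hx j (by push_cast; omega) (by omega))
    convert h3 using 1
    push_cast; ring

end Reaches

/-- The tape is blank far to the right. -/
def BlankRight (τ : ℤ → Fin 2) : Prop := ∃ B : ℤ, ∀ j, B ≤ j → τ j = 0

theorem BlankRight.update {τ : ℤ → Fin 2} (h : BlankRight τ) (x : ℤ) (b : Fin 2) :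
    BlankRight (Function.update τ x b) := by
  obtain ⟨B, hB⟩ := h
  refine ⟨max B (x + 1), fun j hj => ?_⟩
  rw [Function.update_of_ne (by omega)]
  exact hB j (by omega)

theorem fin_two_eq_one {a : Fin 2} (h : a ≠ 0) : a = 1 := by
  revert a; decide

theorem BlankRight.exists_first_zero {τ : ℤ → Fin 2} (h : BlankRight τ) (x : ℤ) :
    ∃ z, x ≤ z ∧ τ z = 0 ∧ ∀ j, x ≤ j → j < z → τ j = 1 := by
  obtain ⟨B, hB⟩ := h
  obtain ⟨z, ⟨hz, hz'⟩, hmin⟩ := Int.exists_least_of_bdd (P := fun z => x ≤ z ∧ τ z = 0)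
    ⟨x, fun z hz => hz.1⟩ ⟨max x B, le_max_left _ _, hB _ (le_max_right _ _)⟩
  refine ⟨z, hz, hz', fun j hj hjz => fin_two_eq_one fun h0 => ?_⟩
  have := hmin j ⟨hj, h0⟩
  omega

/-- A state that sweeps right over ones and fills the first blank. -/
theorem Reaches.fill_right {Q : Type} {δ : Table Q} {τ : ℤ → Fin 2} {q q' : Q}
    (h1 : δ q 1 = (1, Dir.R, some q)) (h0 : δ q 0 = (1, Dir.L, some q'))
    (hτ : BlankRight τ) (x : ℤ) :
    ∃ z, x ≤ z ∧ τ z = 0 ∧ (∀ j, x ≤ j → j < z → τ j = 1) ∧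
      Reaches δ (some q) x τ (some q') (z - 1) (Function.update τ z 1) := by
  obtain ⟨z, hxz, hz, hones⟩ := hτ.exists_first_zero x
  refine ⟨z, hxz, hz, hones, ?_⟩
  have hw := Reaches.walk_right (τ := τ) h1 (z - x).toNat x
    (fun j h h' => hones j h (by omega))
  rw [show x + ((z - x).toNat : ℤ) = z by omega] at hw
  exact hw.trans (Reaches.of_left hz h0)

/-- The blanks of a tape in a finite set of cells. -/
def blanks (τ : ℤ → Fin 2) (s : Finset ℤ) : Finset ℤ := s.filter fun j => τ j = 0

theorem mem_blanks {τ : ℤ → Fin 2} {s : Finset ℤ} {j : ℤ} :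
    j ∈ blanks τ s ↔ j ∈ s ∧ τ j = 0 := Finset.mem_filter

/-- Every blank in the interval `(b, x)` is followed on its left by a one in this interval. -/
def IsolatedBlanks (τ : ℤ → Fin 2) (b x : ℤ) : Prop :=
  ∀ j, b < j → j < x → τ j = 0 → τ (j - 1) = 1 ∧ b < j - 1

/-- The states of the growth engine. -/
inductive Engine : Type
  | back
  | take
  | push
  | double
  | fetch
  | probe
  | restart
  deriving DecidableEq

instance Engine.instFintype : Fintype Engine where
  elems := {.back, .take, .push, .double, .fetch, .probe, .restart}
  complete e := by cases e <;> simp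

theorem Engine.card : Fintype.card Engine = 7 := rfl

/-- The growth engine. A run of ones to the left of a block of `Y` ones makes it replace `Y` by
`2 * Y + 2` once for every one of the run; an isolated blank makes it start over with the whole
block as part of the run; two adjacent blanks make it halt. -/
def Engine.table : Table Engine
  | .back, 1 => (1, .L, some .back)
  | .back, 0 => (1, .L, some .take)
  | .take, 1 => (0, .R, some .push)
  | .take, 0 => (1, .L, some .fetch)
  | .push, 1 => (1, .R, some .push)
  | .push, 0 => (1, .L, some .back)
  | .double, 1 => (1, .R, some .double)
  | .double, 0 => (1, .L, some .take)
  | .fetch, 1 => (0, .R, some .double)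
  | .fetch, 0 => (1, .L, some .probe)
  | .probe, 1 => (1, .R, some .restart)
  | .probe, 0 => (1, .R, none)
  | .restart, 1 => (1, .R, some .restart)
  | .restart, 0 => (1, .L, some .fetch)

namespace Engine

theorem reaches_take (i : ℕ) : ∀ (x y : ℤ) (τ : ℤ → Fin 2), BlankRight τ →
    x < y → (∀ j, x - i < j → j < y → τ j = 1) → τ (x - i) = 0 →
    ∃ τ', Reaches table (some take) x τ (some fetch) (x - i - 1) τ' ∧ BlankRight τ' ∧
      (∀ j < x - i, τ' j = τ j) ∧ (∀ j, τ j = 1 → τ' j = 1) ∧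
      ∀ j, x - i ≤ j → j < y + i → τ' j = 1 := by
  induction i with
  | zero =>
    intro x y τ hτ hxy hones hz
    simp only [Nat.cast_zero, sub_zero, add_zero] at *
    refine ⟨Function.update τ x 1, Reaches.of_left hz rfl, hτ.update _ _, ?_, ?_, ?_⟩
    · intro j hj
      exact Function.update_of_ne (by omega) _ _
    · intro j hj
      by_cases h : j = x
      · simp [h]
      · rwa [Function.update_of_ne h]
    · intro j hj hj'
      by_cases h : j = x
      · simp [h]
      · rw [Function.update_of_ne h]
        exact hones j (by omega) hj'
  | succ i ih =>
    intro x y τ hτ hxy hones hz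
    push_cast at *
    have hx : τ x = 1 := hones x (by omega) hxy
    obtain ⟨z, hxz, hz0, hz1, hr⟩ := Reaches.fill_right (δ := table) (q := .push) (q' := .back)
      rfl rfl (hτ.update x 0) (x + 1)
    have hyz : y ≤ z := by
      by_contra! h
      have := hones z (by omega) h
      rw [Function.update_of_ne (by omega), this] at hz0
      exact absurd hz0 (by decide)
    have hz1' : ∀ j, x < j → j < z → τ j = 1 := fun j hj hj' => by
      have := hz1 j (by omega) hj'
      rwa [Function.update_of_ne (by omega)] at this
    have hw := Reaches.walk_left (δ := table) (q := .back)
      (τ := Function.update (Function.update τ x 0) z 1) rfl (z - 1 - x).toNat (z - 1)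
      (fun j hj hj' => by
        rw [Function.update_of_ne (by omega), Function.update_of_ne (by omega)]
        exact hz1' j (by omega) (by omega))
    rw [show z - 1 - ((z - 1 - x).toNat : ℤ) = x by omega] at hw
    have hb := Reaches.of_left (δ := table) (q := .back)
      (τ := Function.update (Function.update τ x 0) z 1) (x := x) (a := 0)
      (by rw [Function.update_of_ne (by omega), Function.update_self]) rfl
    have hτ1 : Function.update (Function.update (Function.update τ x 0) z 1) x 1 =
        Function.update τ z 1 := by
      rw [Function.update_comm (by omega : z ≠ x), Function.update_idem, ← hx,
        Function.update_eq_self]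
    rw [hτ1] at hb
    have hmono : ∀ j, τ j = 1 → Function.update τ z 1 j = 1 := fun j hj => by
      by_cases h : j = z
      · simp [h]
      · rwa [Function.update_of_ne h]
    obtain ⟨τ', h1, h2, h3, h4, h5⟩ := ih (x - 1) (y + 1) (Function.update τ z 1) (hτ.update _ _)
      (by omega)
      (fun j hj hj' => by
        rcases lt_or_ge j y with h | h
        · exact hmono j (hones j (by omega) h)
        · by_cases hjz : j = z
          · simp [hjz]
          · exact hmono j (hz1' j (by omega) (by omega)))
      (by rw [Function.update_of_ne (by omega)]; rwa [sub_sub, add_comm (1 : ℤ)])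
    refine ⟨τ', ?_, h2, fun j hj => ?_, fun j hj => h4 j (hmono j hj),
      fun j hj hj' => h5 j (by omega) (by omega)⟩
    · have := (((Reaches.of_right (δ := table) (q := .take) hx rfl).trans hr).trans hw).trans
        (hb.trans h1)
      convert this using 1
      ring
    · rw [h3 j (by omega), Function.update_of_ne (by omega)]

/-- One round of the engine: the block of `Y` ones grows to `2 * Y + 2`. -/
theorem reaches_fetch {x : ℤ} {Y : ℕ} {τ : ℤ → Fin 2} (hτ : BlankRight τ) (hx : τ x = 1)
    (hones : ∀ j, x < j → j ≤ x + Y → τ j = 1) :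
    ∃ τ', Reaches table (some fetch) x τ (some fetch) (x - 1) τ' ∧ BlankRight τ' ∧
      (∀ j < x, τ' j = τ j) ∧ (∀ j, τ j = 1 → τ' j = 1) ∧
      ∀ j, x - 1 < j → j ≤ x - 1 + (2 * Y + 2 : ℕ) → τ' j = 1 := by
  obtain ⟨z, hxz, hz0, hz1, hr⟩ := Reaches.fill_right (δ := table) (q := .double) (q' := .take)
    rfl rfl (hτ.update x 0) (x + 1)
  have hyz : x + Y < z := by
    by_contra! h
    have := hones z (by omega) h
    rw [Function.update_of_ne (by omega), this] at hz0
    exact absurd hz0 (by decide)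
  obtain ⟨τ', h1, h2, h3, h4, h5⟩ := reaches_take (z - 1 - x).toNat (z - 1) (z + 1)
    (Function.update (Function.update τ x 0) z 1) ((hτ.update _ _).update _ _) (by omega)
    (fun j hj hj' => by
      by_cases hjz : j = z
      · simp [hjz]
      · rw [Function.update_of_ne hjz]
        exact hz1 j (by omega) (by omega))
    (by rw [show z - 1 - ((z - 1 - x).toNat : ℤ) = x by omega,
          Function.update_of_ne (by omega), Function.update_self])
  rw [show z - 1 - ((z - 1 - x).toNat : ℤ) = x by omega] at h1 h3 h5
  refine ⟨τ', ((Reaches.of_right hx rfl).trans hr).trans h1, h2, fun j hj => ?_, fun j hj => ?_,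
    fun j hj hj' => h5 j (by omega) (by push_cast at hj'; omega)⟩
  · rw [h3 j hj, Function.update_of_ne (by omega), Function.update_of_ne (by omega)]
  · by_cases hjx : j = x
    · exact h5 j (by omega) (by omega)
    · refine h4 j ?_
      by_cases hjz : j = z
      · simp [hjz]
      · rwa [Function.update_of_ne hjz, Function.update_of_ne hjx]

/-- A run of `k` ones makes the block grow exponentially in `k`. -/
theorem reaches_fetch_run (k : ℕ) : ∀ {x : ℤ} {Y : ℕ} {τ : ℤ → Fin 2}, BlankRight τ →
    (∀ j, x - k < j → j ≤ x + Y → τ j = 1) →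
    ∃ τ' Y', Reaches table (some fetch) x τ (some fetch) (x - k) τ' ∧ BlankRight τ' ∧
      (∀ j ≤ x - k, τ' j = τ j) ∧ Y' + 2 = 2 ^ k * (Y + 2) ∧
      ∀ j, x - k < j → j ≤ x - k + (Y' : ℕ) → τ' j = 1 := by
  induction k with
  | zero =>
    intro x Y τ hτ hones
    refine ⟨τ, Y, ?_, hτ, fun _ _ => rfl, by simp, ?_⟩
    · simpa using Reaches.refl _ _ _
    · simpa using hones
  | succ k ih =>
    intro x Y τ hτ hones
    push_cast at hones
    obtain ⟨τ₁, h1, h2, h3, h4, h5⟩ := reaches_fetch (Y := Y) hτ (hones x (by omega) (by omega))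
      (fun j hj hj' => hones j (by omega) hj')
    obtain ⟨τ', Y', g1, g2, g3, g4, g5⟩ := ih (x := x - 1) (Y := 2 * Y + 2) h2
      (fun j hj hj' => by
        rcases lt_or_ge (x - 1) j with h | h
        · exact h5 j h hj'
        · exact h4 j (hones j (by omega) (by omega)))
    have hk : x - ((k + 1 : ℕ) : ℤ) = x - 1 - k := by push_cast; ring
    rw [hk]
    exact ⟨τ', Y', h1.trans g1, g2, fun j hj => (g3 j hj).trans (h3 j (by omega)),
      by rw [g4]; ring, g5⟩

/-- The engine halts from the given configuration, leaving at least `N` ones in a row. -/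
def HaltsWith (N : ℕ) (e : Engine) (x : ℤ) (τ : ℤ → Fin 2) : Prop :=
  ∃ x' τ' a, Reaches table (some e) x τ none x' τ' ∧ ∀ j, a ≤ j → j < a + (N : ℤ) → τ' j = 1

theorem HaltsWith.of_reaches {N : ℕ} {e e' : Engine} {x x' : ℤ} {τ τ' : ℤ → Fin 2}
    (h' : HaltsWith N e' x' τ') (h : Reaches table (some e) x τ (some e') x' τ') :
    HaltsWith N e x τ := by
  obtain ⟨y, τ'', a, hr, ha⟩ := h'
  exact ⟨y, τ'', a, h.trans hr, ha⟩

theorem haltsWith_of_two_blanks {x : ℤ} {g N : ℕ} {τ : ℤ → Fin 2} (hx : τ x = 0)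
    (hx' : τ (x - 1) = 0) (hones : ∀ j, x < j → j ≤ x + g → τ j = 1) (hN : N ≤ g + 2) :
    HaltsWith N fetch x τ := by
  refine ⟨_, _, x - 1, (Reaches.of_left hx rfl).trans (Reaches.of_right (a := 0) ?_ rfl), ?_⟩
  · rwa [Function.update_of_ne (by omega)]
  · intro j hj hj'
    by_cases h : j = x - 1
    · simp [h]
    · rw [Function.update_of_ne h]
      by_cases h' : j = x
      · simp [h']
      · rw [Function.update_of_ne h']
        exact hones j (by omega) (by omega)

theorem haltsWith_of_run {K : ℕ} {b x : ℤ} {τ : ℤ → Fin 2} (hτ : BlankRight τ)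
    (hb : ∀ j < b, τ j = 0) (hK : b + K ≤ x) (hones : ∀ j, b < j → j ≤ x + 1 → τ j = 1) :
    HaltsWith (3 * 2 ^ K) fetch x τ := by
  obtain ⟨τ', Y', g1, g2, g3, g4, g5⟩ := reaches_fetch_run (x - b).toNat (x := x) (Y := 1) hτ
    (fun j hj hj' => hones j (by omega) (by simpa using hj'))
  rw [show x - ((x - b).toNat : ℤ) = b by omega] at g1 g3 g5
  have hpow : 2 ^ K ≤ 2 ^ (x - b).toNat := Nat.pow_le_pow_right (by norm_num) (by omega)
  refine HaltsWith.of_reaches ?_ g1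
  by_cases h0 : τ' b = 0
  · exact haltsWith_of_two_blanks h0 (by rw [g3 _ (by omega), hb _ (by omega)]) g5 (by omega)
  · obtain ⟨τ₁, h1, h2, h3, h4, h5⟩ := reaches_fetch g2 (fin_two_eq_one h0) g5
    refine (haltsWith_of_two_blanks ?_ ?_ h5 (by omega)).of_reaches h1
    · rw [h3 _ (by omega), g3 _ (by omega), hb _ (by omega)]
    · rw [h3 _ (by omega), g3 _ (by omega), hb _ (by omega)]

/-- As long as a blank is left in the run, the engine eventually starts over. -/
theorem exists_reaches_restart {b R : ℤ} {m : ℕ} (k : ℕ) : ∀ {x : ℤ} {τ : ℤ → Fin 2},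
    x - b = k → BlankRight τ → (∀ j < b, τ j = 0) → IsolatedBlanks τ b (x + 1) →
    (blanks τ (Finset.Ioo b (x + 1))).card = m + 1 →
    (blanks τ (Finset.Icc (x + 1) R)).card ≤ m →
    ∃ x' τ', Reaches table (some fetch) x τ (some restart) x' τ' ∧ BlankRight τ' ∧
      (∀ j < b, τ' j = 0) ∧ IsolatedBlanks τ' b x' ∧ b < x' ∧
      (blanks τ' (Finset.Ioo b x')).card = m ∧ (blanks τ' (Finset.Icc x' R)).card ≤ m := by
  induction k with
  | zero =>
    intro x τ hk _ _ _ hcard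
    have : Finset.Ioo b (x + 1) = ∅ := by
      ext j; simp; omega
    simp [this, blanks] at hcard
  | succ k ih =>
    intro x τ hk hτ hb hiso hl hr
    push_cast at hk
    by_cases hx : τ x = 0
    · obtain ⟨hx1, hbx⟩ := hiso x (by omega) (by omega) hx
      refine ⟨x, Function.update τ x 1, ?_, hτ.update _ _, ?_, ?_, by omega, ?_, ?_⟩
      · have h1 := Reaches.of_left (δ := table) (q := .fetch) hx rfl
        have hx1' : Function.update τ x 1 (x - 1) = 1 := by
          rwa [Function.update_of_ne (by omega)]
        have h2 := Reaches.of_right (δ := table) (q := .probe) hx1' rfl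
        rw [sub_add_cancel] at h2
        have h3 := h1.trans h2
        rwa [show Function.update (Function.update τ x 1) (x - 1) 1 = Function.update τ x 1 from
          Function.update_eq_self_iff.2 hx1'.symm] at h3
      · intro j hj
        rw [Function.update_of_ne (by omega)]
        exact hb j hj
      · intro j hj hj' h0
        rw [Function.update_of_ne (by omega)] at h0
        rw [Function.update_of_ne (by omega)]
        exact hiso j hj (by omega) h0
      · have : blanks τ (Finset.Ioo b (x + 1)) =
            insert x (blanks (Function.update τ x 1) (Finset.Ioo b x)) := by
          ext j
          simp only [mem_blanks, Finset.mem_insert, Finset.mem_Ioo]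
          by_cases hjx : j = x
          · simp [hjx, hx]; omega
          · rw [Function.update_of_ne hjx]
            simp only [hjx, false_or]
            constructor <;> rintro ⟨h1, h2⟩ <;> exact ⟨by omega, h2⟩
        rw [this, Finset.card_insert_of_notMem (by simp [mem_blanks])] at hl
        omega
      · refine (Finset.card_le_card ?_).trans hr
        intro j
        simp only [mem_blanks, Finset.mem_Icc]
        rintro ⟨h1, h2⟩
        have hjx : j ≠ x := by
          rintro rfl
          simp at h2
        rw [Function.update_of_ne hjx] at h2
        exact ⟨by omega, h2⟩
    · obtain ⟨τ₁, h1, h2, h3, h4, h5⟩ := reaches_fetch (Y := 0) hτ (fin_two_eq_one hx)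
        (fun j hj hj' => by simp at hj'; omega)
      have hx1 : τ₁ x = 1 := h4 x (fin_two_eq_one hx)
      obtain ⟨x', τ', g1, g2, g3⟩ := ih (x := x - 1) (τ := τ₁) (by omega) h2
        (fun j hj => by rw [h3 j (by omega), hb j hj])
        (fun j hj hj' h0 => by
          rw [h3 j (by omega)] at h0
          rw [h3 _ (by omega)]
          exact hiso j hj (by omega) h0)
        (by
          rw [← hl]
          congr 1
          ext j
          simp only [mem_blanks, Finset.mem_Ioo]
          constructor
          · rintro ⟨h, h'⟩
            exact ⟨by omega, by rwa [← h3 j (by omega)]⟩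
          · rintro ⟨h, h'⟩
            have hjx : j ≠ x := by
              rintro rfl
              exact hx h'
            exact ⟨by omega, by rwa [h3 j (by omega)]⟩)
        (by
          refine (Finset.card_le_card ?_).trans hr
          intro j
          simp only [mem_blanks, Finset.mem_Icc]
          rintro ⟨h, h'⟩
          have hjx : j ≠ x := by
            rintro rfl
            rw [hx1] at h'
            exact absurd h' (by decide)
          refine ⟨by omega, ?_⟩
          by_contra h0
          rw [h4 j (fin_two_eq_one h0)] at h'
          exact absurd h' (by decide))
      exact ⟨x', τ', h1.trans g1, g2, g3⟩

/-- If at least as many blanks lie in the run as have to be filled up to cell `b + K`, then the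
engine ends up with a run of at least `K` ones. -/
theorem haltsWith_restart {b : ℤ} {K : ℕ} (m : ℕ) : ∀ {x : ℤ} {τ : ℤ → Fin 2},
    BlankRight τ → (∀ j < b, τ j = 0) → IsolatedBlanks τ b x → b < x →
    (blanks τ (Finset.Ioo b x)).card = m → (blanks τ (Finset.Icc x (b + K))).card ≤ m →
    HaltsWith (3 * 2 ^ K) restart x τ := by
  induction m with
  | zero =>
    intro x τ hτ hb hiso hbx hl hr
    obtain ⟨z, hxz, hz0, hz1, h⟩ := Reaches.fill_right (δ := table) (q := .restart)
      (q' := .fetch) rfl rfl hτ x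
    refine HaltsWith.of_reaches ?_ h
    have hzK : b + K < z := by
      by_contra! hz
      have : z ∈ blanks τ (Finset.Icc x (b + K)) :=
        mem_blanks.2 ⟨Finset.mem_Icc.2 ⟨hxz, hz⟩, hz0⟩
      rw [Finset.card_eq_zero.1 (Nat.le_zero.1 hr)] at this
      simp at this
    refine haltsWith_of_run (b := b) (hτ.update _ _) (fun j hj => ?_) (by omega)
      (fun j hj hj' => ?_)
    · rw [Function.update_of_ne (by omega)]
      exact hb j hj
    · by_cases hjz : j = z
      · simp [hjz]
      · rw [Function.update_of_ne hjz]
        rcases lt_or_ge j x with h | h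
        · refine fin_two_eq_one fun h0 => ?_
          have : j ∈ blanks τ (Finset.Ioo b x) :=
            mem_blanks.2 ⟨Finset.mem_Ioo.2 ⟨hj, h⟩, h0⟩
          rw [Finset.card_eq_zero.1 hl] at this
          simp at this
        · exact hz1 j h (by omega)
  | succ m ih =>
    intro x τ hτ hb hiso hbx hl hr
    obtain ⟨z, hxz, hz0, hz1, h⟩ := Reaches.fill_right (δ := table) (q := .restart)
      (q' := .fetch) rfl rfl hτ x
    have hlt : ∀ j, j < z → Function.update τ z 1 j = τ j := fun j hj =>
      Function.update_of_ne (by omega) _ _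
    obtain ⟨x', τ', g1, g2, g3, g4, g5, g6, g7⟩ := exists_reaches_restart (b := b) (R := b + K)
      (m := m) (z - 1 - b).toNat (x := z - 1) (τ := Function.update τ z 1) (by omega)
      (hτ.update _ _) (fun j hj => by rw [hlt j (by omega), hb j hj])
      (fun j hj hj' h0 => by
        rw [hlt j (by omega)] at h0
        rw [hlt _ (by omega)]
        refine hiso j hj ?_ h0
        by_contra! hxj
        rw [hz1 j hxj (by omega)] at h0
        exact absurd h0 (by decide))
      (by
        rw [← hl]
        congr 1
        ext j
        simp only [mem_blanks, Finset.mem_Ioo]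
        constructor
        · rintro ⟨h, h'⟩
          rw [hlt j (by omega)] at h'
          refine ⟨⟨h.1, ?_⟩, h'⟩
          by_contra! hxj
          rw [hz1 j hxj (by omega)] at h'
          exact absurd h' (by decide)
        · rintro ⟨h, h'⟩
          exact ⟨by omega, by rwa [hlt j (by omega)]⟩)
      (by
        have hsub : blanks (Function.update τ z 1) (Finset.Icc (z - 1 + 1) (b + K)) ⊆
            (blanks τ (Finset.Icc x (b + K))).erase z := by
          intro j
          simp only [mem_blanks, Finset.mem_Icc, Finset.mem_erase]
          rintro ⟨h, h'⟩
          have hjz : j ≠ z := by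
            rintro rfl
            simp at h'
          rw [Function.update_of_ne hjz] at h'
          exact ⟨hjz, by omega, h'⟩
        refine (Finset.card_le_card hsub).trans ?_
        by_cases hzK : z ≤ b + K
        · rw [Finset.card_erase_of_mem (mem_blanks.2 ⟨Finset.mem_Icc.2 ⟨hxz, hzK⟩, hz0⟩)]
          omega
        · have : blanks τ (Finset.Icc x (b + K)) = ∅ := by
            ext j
            simp only [mem_blanks, Finset.mem_Icc, Finset.notMem_empty, iff_false]
            rintro ⟨h, h'⟩
            rw [hz1 j h.1 (by omega)] at h'
            exact absurd h' (by decide)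
          simp [this])
    exact (ih g2 g3 g4 g5 g6 g7).of_reaches (h.trans g1)

end Engine

theorem Reaches.exists_iterate {n : ℕ} {M : Machine n 2} {o o' : Option (Fin n)} {x x' : ℤ}
    {τ τ' : ℤ → Fin 2} (h : Reaches M o x τ o' x' τ') :
    ∃ m, (step M)^[m] ⟨o, x, τ⟩ = ⟨o', x', τ'⟩ := by
  induction h with
  | refl => exact ⟨0, rfl⟩
  | head _ ih =>
    obtain ⟨m, hm⟩ := ih
    exact ⟨m + 1, hm⟩

theorem iterate_step_of_state_eq_none {n k : ℕ} {M : Machine n k} {c : Cfg n k}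
    (h : c.state = none) (m : ℕ) : (step M)^[m] c = c :=
  Function.iterate_fixed (by simp [step, h]) m

theorem exists_haltsIn {n k : ℕ} {M : Machine n k} {c : Cfg n k} {m : ℕ}
    (h : ((step M)^[m] c).state = none) :
    ∃ t, HaltsIn M c t ∧ (step M)^[t] c = (step M)^[m] c := by
  classical
  have hex : ∃ m, ((step M)^[m] c).state = none := ⟨m, h⟩
  refine ⟨Nat.find hex, ⟨Nat.find_spec hex, fun i hi => Nat.find_min hex hi⟩, ?_⟩
  obtain ⟨d, rfl⟩ := Nat.exists_eq_add_of_le' (Nat.find_min' hex h)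
  rw [Function.iterate_add_apply, iterate_step_of_state_eq_none (Nat.find_spec hex)]

theorem HaltsIn.unique {n k : ℕ} {M : Machine n k} {c : Cfg n k} {t t' : ℕ}
    (h : HaltsIn M c t) (h' : HaltsIn M c t') : t = t' := by
  rcases lt_trichotomy t t' with hlt | heq | hlt
  · exact absurd h.1 (h'.2 t hlt)
  · exact heq
  · exact absurd h'.1 (h.2 t' hlt)

instance Dir.instFinite : Finite Dir :=
  Finite.of_surjective (fun b : Bool => cond b Dir.L Dir.R)
    fun d => by cases d <;> [exact ⟨true, rfl⟩; exact ⟨false, rfl⟩]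

theorem bddAbove_scores (n k : ℕ) [NeZero k] :
    BddAbove {m : ℕ | ∃ M : Machine n k, Valid M ∧
      ∃ t : ℕ, HaltsIn M (init n k) t ∧ sigmaCount ((step M)^[t] (init n k)) = m} := by
  rw [Set.ofPred_exists]
  refine (Set.finite_iUnion fun M => Set.Subsingleton.finite ?_).bddAbove
  rintro _ ⟨-, t, ht, rfl⟩ _ ⟨-, t', ht', rfl⟩
  rw [ht.unique ht']

theorem le_sigmaCount {n : ℕ} {c : Cfg n 2} {a : ℤ} {m : ℕ} (hfin : {i | c.tape i ≠ 0}.Finite)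
    (h : ∀ j, a ≤ j → j < a + (m : ℤ) → c.tape j = 1) : m ≤ sigmaCount c := by
  have hcard : (Finset.Ico a (a + m) : Finset ℤ).card = m := by simp
  rw [sigmaCount, ← hcard, ← Set.ncard_coe_finset]
  refine Set.ncard_le_ncard (fun j hj => ?_) hfin
  rw [Finset.coe_Ico] at hj
  simp [h j hj.1 hj.2]

/-- A halting table with states in an arbitrary type bounds the score from below. -/
theorem le_bbSigma {Q : Type} [Fintype Q] [DecidableEq Q] {δ : Table Q} {start : Q} {N m : ℕ}
    {x a : ℤ} {τ : ℤ → Fin 2} (hN : Fintype.card Q = N)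
    (hδ : ∀ q a, (δ q a).2.2 = none → (δ q a).1 = 1 ∧ (δ q a).2.1 = Dir.R)
    (h : Reaches δ (some start) 0 (fun _ => 0) none x τ)
    (hm : ∀ j, a ≤ j → j < a + (m : ℤ) → τ j = 1) : m ≤ bbSigma N 2 := by
  have hpos : 0 < N := hN ▸ Fintype.card_pos_iff.2 ⟨start⟩
  obtain ⟨e, he⟩ : ∃ e : Q ≃ Fin N, e start = ⟨0, hpos⟩ := by
    let e := Fintype.equivFinOfCardEq hN
    exact ⟨e.trans (Equiv.swap (e start) ⟨0, hpos⟩), by simp⟩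
  let M : Machine N 2 := fun q a =>
    ((δ (e.symm q) a).1, (δ (e.symm q) a).2.1, (δ (e.symm q) a).2.2.map e)
  have hM : Valid M := fun q a hq => hδ _ _ (Option.map_eq_none_iff.1 hq)
  have h' : Reaches M (some ⟨0, hpos⟩) 0 (fun _ => 0) none x τ := by
    have := h.map (δ' := M) (Option.map e) fun q => ⟨e q, rfl, fun a => by simp [M]⟩
    simpa [he] using this
  obtain ⟨s, hs⟩ := h'.exists_iterate
  have hinit : init N 2 = ⟨some ⟨0, hpos⟩, 0, fun _ => 0⟩ := by simp [init, hpos]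
  rw [← hinit] at hs
  obtain ⟨t, ht, hts⟩ := exists_haltsIn (M := M) (c := init N 2) (m := s) (by rw [hs])
  refine (le_sigmaCount (c := (step M)^[t] (init N 2)) (a := a) ?_ ?_).trans
    (le_csSup (bddAbove_scores N 2) ⟨M, hM, t, ht, rfl⟩)
  · rw [hts, hs]
    exact h.finite_support (by simp)
  · rw [hts, hs]
    exact hm

/-- The table of a front end whose exit is wired to the restarting state of the growth engine. -/
def attach {P : Type} (δ : Table P) : Table (P ⊕ Engine)
  | .inl p, a => ((δ p a).1, (δ p a).2.1, some ((δ p a).2.2.elim (.inr .restart) .inl))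
  | .inr e, a => ((Engine.table e a).1, (Engine.table e a).2.1, (Engine.table e a).2.2.map .inr)

theorem Reaches.blankRight {Q : Type} {δ : Table Q} {o o' : Option Q} {x x' : ℤ}
    {τ τ' : ℤ → Fin 2} (h : Reaches δ o x τ o' x' τ') (hτ : BlankRight τ) : BlankRight τ' := by
  induction h with
  | refl => exact hτ
  | head _ ih => exact ih (hτ.update _ _)

/-- A front end that prepares a suitable tape for the growth engine. -/
theorem le_bbSigma_of_reaches {P : Type} [Fintype P] [DecidableEq P] {δ : Table P} {p : P}
    {N K : ℕ} {b x : ℤ} {τ : ℤ → Fin 2} (hN : Fintype.card P + 7 = N)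
    (h : Reaches δ (some p) 0 (fun _ => 0) none x τ) (hb : ∀ j < b, τ j = 0)
    (hiso : IsolatedBlanks τ b x) (hbx : b < x)
    (hcard : (blanks τ (Finset.Icc x (b + K))).card ≤ (blanks τ (Finset.Ioo b x)).card) :
    3 * 2 ^ K ≤ bbSigma N 2 := by
  obtain ⟨x', τ', a, hr, ha⟩ := Engine.haltsWith_restart (K := K) _
    (h.blankRight ⟨0, fun _ _ => rfl⟩) hb hiso hbx rfl hcard
  have h1 : Reaches (attach δ) (some (.inl p)) 0 (fun _ => 0) (some (.inr .restart)) x τ :=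
    h.map (fun o => some (o.elim (Sum.inr Engine.restart) Sum.inl))
      fun q => ⟨.inl q, rfl, fun a => rfl⟩
  have h2 : Reaches (attach δ) (some (.inr .restart)) x τ none x' τ' :=
    hr.map (Option.map Sum.inr) fun q => ⟨.inr q, rfl, fun a => rfl⟩
  refine le_bbSigma (by rw [Fintype.card_sum, Engine.card, hN]) ?_ (h1.trans h2) ha
  rintro (q | e) a h0
  · exact absurd h0 (by simp [attach])
  · revert h0
    cases e <;> fin_cases a <;> simp [attach, Engine.table]

/-- The tape with ones on the cells `0, …, k - 1`, except for cell `1`. -/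
def pattern (k : ℕ) (j : ℤ) : Fin 2 := if 0 ≤ j ∧ j < k ∧ j ≠ 1 then 1 else 0

/-- A front end that writes `pattern L`, one cell for each state. -/
def writer (L : ℕ) : Table (Fin L) := fun k _ =>
  (if (k : ℕ) = 1 then 0 else 1, .R, if h : (k : ℕ) + 1 < L then some ⟨k + 1, h⟩ else none)

theorem reaches_writer {L : ℕ} (d : ℕ) : ∀ k, k + d = L →
    Reaches (writer L) (if h : k < L then some ⟨k, h⟩ else none) k (pattern k)
      none L (pattern L) := by
  induction d with
  | zero =>
    rintro k rfl
    simpa using Reaches.refl _ _ _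
  | succ d ih =>
    intro k hk
    rw [dif_pos (by omega)]
    refine Reaches.head ?_
    convert ih (k + 1) (by omega) using 1
    · simp [writer]
    · simp [writer, Dir.move]
    · ext1 j
      simp only [writer, pattern, Function.update_apply]
      push_cast
      split_ifs <;> first | rfl | omega

theorem three_mul_two_pow_le_bbSigma {n : ℕ} (hn : 1 ≤ n) :
    3 * 2 ^ (3 * n) ≤ bbSigma (3 * n + 6) 2 := by
  have h := reaches_writer (L := 3 * n - 1) (3 * n - 1) 0 (by omega)
  rw [dif_pos (by omega), show pattern 0 = fun _ => 0 by ext1 j; simp [pattern]; omega] at h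
  have hpat : ∀ j, pattern (3 * n - 1) j = 0 ↔ ¬(0 ≤ j ∧ j < 3 * (n : ℤ) - 1 ∧ j ≠ 1) := by
    intro j
    rw [pattern, show ((3 * n - 1 : ℕ) : ℤ) = 3 * n - 1 by omega]
    split_ifs with hj <;> simp [hj]
  refine le_bbSigma_of_reaches (b := -1) (by rw [Fintype.card_fin]; omega) h ?_ ?_ (by omega) ?_
  · intro j hj
    rw [hpat]
    omega
  · intro j hj hj' h0
    rw [hpat] at h0
    obtain rfl : j = 1 := by omega
    refine ⟨fin_two_eq_one ?_, by norm_num⟩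
    rw [Ne, hpat]
    omega
  · calc _ ≤ (Finset.Icc ((3 * n - 1 : ℕ) : ℤ) (-1 + (3 * n : ℕ))).card :=
          Finset.card_le_card (Finset.filter_subset _ _)
      _ ≤ 1 := by rw [Int.card_Icc]; omega
      _ ≤ _ := Finset.card_pos.2 ⟨1, mem_blanks.2 ⟨Finset.mem_Ioo.2 (by omega), by
          rw [hpat]; omega⟩⟩

/-- The minimum of `f 0, …, f i`. -/
def runMin (f : ℕ → ℤ) : ℕ → ℤ
  | 0 => f 0
  | i + 1 => min (runMin f i) (f (i + 1))

/-- The maximum of `f 0, …, f i`. -/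
def runMax (f : ℕ → ℤ) (i : ℕ) : ℤ := -runMin (fun k => -f k) i

theorem runMin_succ (f : ℕ → ℤ) (i : ℕ) : runMin f (i + 1) = min (runMin f i) (f (i + 1)) := rfl

theorem runMax_succ (f : ℕ → ℤ) (i : ℕ) : runMax f (i + 1) = max (runMax f i) (f (i + 1)) := by
  simp only [runMax, runMin_succ]
  omega

theorem runMin_le (f : ℕ → ℤ) {i k : ℕ} (h : k ≤ i) : runMin f i ≤ f k := by
  induction i with
  | zero => rw [Nat.le_zero.1 h, runMin]
  | succ i ih =>
    rw [runMin_succ]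
    rcases Nat.of_le_succ h with h | rfl
    · exact (min_le_left _ _).trans (ih h)
    · exact min_le_right _ _

theorem le_runMax (f : ℕ → ℤ) {i k : ℕ} (h : k ≤ i) : f k ≤ runMax f i := by
  have := runMin_le (fun k => -f k) h
  rw [runMax]
  omega

/-- The tape of `a` spread over the even cells, with a one between any two cells of `[l, r]`. -/
def interleave (l r : ℤ) (a : ℤ → Fin 2) (j : ℤ) : Fin 2 :=
  if j % 2 = 0 then a (j / 2) else if l < (j + 1) / 2 ∧ (j + 1) / 2 ≤ r then 1 else 0

theorem interleave_two_mul (l r : ℤ) (a : ℤ → Fin 2) (j : ℤ) :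
    interleave l r a (2 * j) = a j := by
  simp [interleave]

theorem interleave_update {l r p : ℤ} {a : ℤ → Fin 2} (hl : l ≤ p) (hr : p ≤ r) (b : Fin 2)
    (d : Dir) :
    Function.update (Function.update (interleave l r a) (2 * p) b) (2 * p + d.move) 1 =
      interleave (min l (p + d.move)) (max r (p + d.move)) (Function.update a p b) := by
  funext j
  have hd : d.move = 1 ∨ d.move = -1 := by cases d <;> simp [Dir.move]
  obtain ⟨k, hk | hk⟩ : ∃ k, j = 2 * k ∨ j = 2 * k - 1 := ⟨(j + 1) / 2, by omega⟩
  · subst hk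
    rw [interleave_two_mul, Function.update_of_ne (by omega)]
    by_cases h : k = p
    · simp [h]
    · rw [Function.update_of_ne h, Function.update_of_ne (by omega), interleave_two_mul]
  · subst hk
    simp only [Function.update_apply, interleave]
    rw [show (2 * k - 1 + 1) / 2 = k by omega]
    split_ifs <;> first | rfl | omega

/-- A front end that simulates the machine `M` on a spread-out tape until the transition `z` is to
be performed, marking the borders between the cells visited. -/
def simulator {n : ℕ} (M : Machine n 2) (z : Fin n × Fin 2) : Table (Fin n ⊕ {y // y ≠ z})
  | .inl q, a =>
    if h : (q, a) ≠ z then ((M q a).1, (M q a).2.1, some (.inr ⟨(q, a), h⟩)) else (1, .R, none)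
  | .inr y, _ => (1, (M y.1.1 y.1.2).2.1, (M y.1.1 y.1.2).2.2.map .inl)

theorem card_simulator {n : ℕ} (z : Fin n × Fin 2) :
    Fintype.card (Fin n ⊕ {y // y ≠ z}) = 3 * n - 1 := by
  have : 0 < n := z.1.pos
  rw [Fintype.card_sum, Fintype.card_subtype_compl, Fintype.card_prod, Fintype.card_fin,
    Fintype.card_fin, Fintype.card_subtype_eq]
  omega

theorem reaches_simulator_step {n : ℕ} (M : Machine n 2) {z : Fin n × Fin 2} {q : Fin n}
    {l r p : ℤ} {a : ℤ → Fin 2} (hl : l ≤ p) (hr : p ≤ r) (hz : (q, a p) ≠ z) :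
    Reaches (simulator M z) (some (.inl q)) (2 * p) (interleave l r a)
      ((M q (a p)).2.2.map .inl) (2 * (p + (M q (a p)).2.1.move))
      (interleave (min l (p + (M q (a p)).2.1.move)) (max r (p + (M q (a p)).2.1.move))
        (Function.update a p (M q (a p)).1)) := by
  refine Reaches.head ?_
  rw [interleave_two_mul, simulator, dif_pos hz]
  refine Reaches.head ?_
  rw [simulator, interleave_update hl hr]
  convert Reaches.refl _ _ _ using 1
  ring

section Run

variable {n : ℕ} (M : Machine n 2)

variable {M} in
theorem tape_step_of_ne {c : Cfg n 2} {j : ℤ} (h : c.pos ≠ j) : (step M c).tape j = c.tape j := by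
  rw [step]
  split
  · rfl
  · exact Function.update_of_ne h.symm _ _

/-- The position of the head after `i` steps on the initially blank tape. -/
def headPos (i : ℕ) : ℤ := ((step M)^[i] (init n 2)).pos

theorem iterate_step_succ (i : ℕ) :
    (step M)^[i + 1] (init n 2) = step M ((step M)^[i] (init n 2)) :=
  Function.iterate_succ_apply' _ _ _

theorem state_ne_none_of_le {c : Cfg n 2} {i u : ℕ} (hiu : i ≤ u)
    (hu : ((step M)^[u] c).state ≠ none) : ((step M)^[i] c).state ≠ none := by
  intro h
  obtain ⟨d, rfl⟩ := Nat.exists_eq_add_of_le' hiu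
  rw [Function.iterate_add_apply, iterate_step_of_state_eq_none h] at hu
  exact hu h

theorem exists_headPos_eq_of_tape_ne_zero {i : ℕ} {j : ℤ}
    (h : ((step M)^[i] (init n 2)).tape j ≠ 0) : ∃ k ≤ i, headPos M k = j := by
  induction i with
  | zero => exact absurd rfl h
  | succ i ih =>
    by_cases hj : headPos M i = j
    · exact ⟨i, by omega, hj⟩
    · suffices ((step M)^[i] (init n 2)).tape j ≠ 0 by
        obtain ⟨k, hk, hkj⟩ := ih this
        exact ⟨k, by omega, hkj⟩
      rwa [iterate_step_succ, tape_step_of_ne hj] at h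

theorem tape_eq_zero_of_lt {i u : ℕ} (hiu : i ≤ u) {j : ℤ} (h : j < runMin (headPos M) u) :
    ((step M)^[i] (init n 2)).tape j = 0 := by
  by_contra h0
  obtain ⟨k, hk, rfl⟩ := exists_headPos_eq_of_tape_ne_zero M h0
  exact absurd (runMin_le (headPos M) (hk.trans hiu)) (by omega)

theorem tape_eq_zero_of_gt {i u : ℕ} (hiu : i ≤ u) {j : ℤ} (h : runMax (headPos M) u < j) :
    ((step M)^[i] (init n 2)).tape j = 0 := by
  by_contra h0
  obtain ⟨k, hk, rfl⟩ := exists_headPos_eq_of_tape_ne_zero M h0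
  exact absurd (le_runMax (headPos M) (hk.trans hiu)) (by omega)

variable {M}

theorem reaches_simulator {u : ℕ} {q₀ q : Fin n} {p : ℤ} {a : ℤ → Fin 2} (hq₀ : (q₀ : ℕ) = 0)
    (hu : (step M)^[u] (init n 2) = ⟨some q, p, a⟩) (hq : (M q (a p)).2.2 = none) (i : ℕ)
    (hi : i ≤ u) : Reaches (simulator M (q, a p)) (some (.inl q₀)) 0 (fun _ => 0)
      (((step M)^[i] (init n 2)).state.map .inl) (2 * headPos M i)
      (interleave (runMin (headPos M) i) (runMax (headPos M) i)
        ((step M)^[i] (init n 2)).tape) := by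
  induction i with
  | zero =>
    convert Reaches.refl _ _ _ using 1
    · have : (⟨0, q₀.pos⟩ : Fin n) = q₀ := Fin.ext hq₀.symm
      simp [init, q₀.pos, this]
    · simp [headPos, init]
    · funext j
      rw [show runMin (headPos M) 0 = 0 from rfl, show runMax (headPos M) 0 = 0 from rfl, interleave]
      split_ifs <;> first | rfl | omega
  | succ i ih =>
    have hne := state_ne_none_of_le M hi (c := init n 2) (by simp [hu])
    refine (ih (by omega)).trans ?_
    rw [runMin_succ, runMax_succ]
    have hl := runMin_le (headPos M) (le_refl i)
    have hr := le_runMax (headPos M) (le_refl i)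
    have hpos : headPos M (i + 1) = (step M ((step M)^[i] (init n 2))).pos := by
      rw [headPos, iterate_step_succ]
    rw [hpos]
    rw [iterate_step_succ] at hne ⊢
    rw [headPos] at hl hr ⊢
    rcases hc : (step M)^[i] (init n 2) with ⟨_ | q', p', a'⟩
    · simp [hc, step] at hne
    · rw [hc] at hl hr hne
      refine reaches_simulator_step M hl hr fun h => hne ?_
      obtain ⟨rfl, ha⟩ := Prod.mk.inj h
      rw [← ha] at hq
      simpa [step] using hq

theorem runMin_le_pos {u : ℕ} {q : Fin n} {p : ℤ} {a : ℤ → Fin 2}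
    (hu : (step M)^[u] (init n 2) = ⟨some q, p, a⟩) :
    runMin (headPos M) u ≤ p ∧ p ≤ runMax (headPos M) u := by
  have hp : headPos M u = p := by rw [headPos, hu]
  exact ⟨hp ▸ runMin_le _ le_rfl, hp ▸ le_runMax _ le_rfl⟩

/-- The score obtained by simulating `M` if at least as many blanks remain to the left of the final
head position as to its right. -/
theorem le_bbSigma_of_card_blanks_le {u K : ℕ} {q : Fin n} {p : ℤ} {a : ℤ → Fin 2}
    (hu : (step M)^[u] (init n 2) = ⟨some q, p, a⟩) (hq : (M q (a p)).2.2 = none)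
    (hK : 2 * runMin (headPos M) u + K + 1 = 2 * runMax (headPos M) u)
    (hcard : (blanks a (Finset.Ioo p (runMax (headPos M) u))).card ≤
      (blanks a (Finset.Ioo (runMin (headPos M) u) p)).card) :
    3 * 2 ^ K ≤ bbSigma (3 * n + 6) 2 := by
  have hn := q.pos
  obtain ⟨hl, hr⟩ := runMin_le_pos hu
  have hsim := reaches_simulator (q₀ := ⟨0, hn⟩) rfl hu hq u le_rfl
  have hleft : ∀ j < runMin (headPos M) u, a j = 0 := fun j hj => by
    simpa [hu] using tape_eq_zero_of_lt M le_rfl hj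
  rw [hu, headPos, hu] at hsim
  generalize runMin (headPos M) u = l at *
  generalize runMax (headPos M) u = r at *
  simp only [Option.map_some] at hsim
  have hexit := Reaches.of_right (δ := simulator M (q, a p)) (q := .inl q) (b := 1) (o := none)
    (interleave_two_mul l r a p) (by simp [simulator])
  set τ := Function.update (interleave l r a) (2 * p) 1 with hτ
  have heven : ∀ k, k ≠ p → τ (2 * k) = a k := fun k hk => by
    rw [hτ, Function.update_of_ne (by omega), interleave_two_mul]
  have hodd : ∀ k, τ (2 * k - 1) = if l < k ∧ k ≤ r then 1 else 0 := fun k => by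
    rw [hτ, Function.update_of_ne (by omega), interleave, if_neg (by omega),
      show (2 * k - 1 + 1) / 2 = k by omega]
  have hself : τ (2 * p) = 1 := Function.update_self _ _ _
  have hcases : ∀ j : ℤ, ∃ k, j = 2 * k ∨ j = 2 * k - 1 := fun j => ⟨(j + 1) / 2, by omega⟩
  have hblank : ∀ j, 2 * l < j → j < 2 * r → τ j = 0 → ∃ k, k ≠ p ∧ j = 2 * k ∧ a k = 0 := by
    intro j hj hj' h0
    obtain ⟨k, rfl | rfl⟩ := hcases j
    · by_cases hk : k = p
      · subst hk
        rw [hself] at h0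
        exact absurd h0 (by decide)
      · exact ⟨k, hk, rfl, by rwa [← heven k hk]⟩
    · rw [hodd, if_pos (by omega)] at h0
      exact absurd h0 (by decide)
  refine le_bbSigma_of_reaches (b := 2 * l) (by rw [card_simulator]; omega) (hsim.trans hexit)
    ?_ ?_ (by omega) ?_
  · intro j hj
    obtain ⟨k, rfl | rfl⟩ := hcases j
    · rw [heven k (by omega), hleft k (by omega)]
    · rw [hodd, if_neg (by omega)]
  · intro j hj hj' h0
    obtain ⟨k, rfl | rfl⟩ := hcases j
    · rw [hodd, if_pos (by omega)]
      exact ⟨rfl, by omega⟩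
    · rw [hodd, if_pos (by omega)] at h0
      exact absurd h0 (by decide)
  · have hinj : Function.Injective fun k : ℤ => 2 * k := fun _ _ h => by
      simpa using h
    refine (Finset.card_le_card ?_).trans
      ((Finset.card_image_le (s := blanks a (Finset.Ioo p r)) (f := fun k => 2 * k)).trans
        (hcard.trans ((Finset.card_image_of_injective _ hinj).ge.trans (Finset.card_le_card ?_))))
    · intro j hj
      rw [mem_blanks, Finset.mem_Icc] at hj
      obtain ⟨k, -, rfl, hk⟩ := hblank j (by omega) (by omega) hj.2
      exact Finset.mem_image.2 ⟨k, mem_blanks.2 ⟨Finset.mem_Ioo.2 (by omega), hk⟩, rfl⟩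
    · intro j hj
      obtain ⟨k, hk, rfl⟩ := Finset.mem_image.1 hj
      rw [mem_blanks, Finset.mem_Ioo] at hk
      rw [mem_blanks, Finset.mem_Ioo, heven k (by omega)]
      exact ⟨by omega, hk.2⟩

/-- The opposite direction. -/
def Dir.flip : Dir → Dir
  | .L => .R
  | .R => .L

theorem Dir.move_flip (d : Dir) : d.flip.move = -d.move := by
  cases d <;> simp [Dir.flip, Dir.move]

/-- The machine with left and right interchanged. -/
def mirror (M : Machine n 2) : Machine n 2 := fun q a =>
  ((M q a).1, (M q a).2.1.flip, (M q a).2.2)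

/-- The configuration with left and right interchanged. -/
def Cfg.mirror (c : Cfg n 2) : Cfg n 2 := ⟨c.state, -c.pos, fun j => c.tape (-j)⟩

theorem step_mirror (c : Cfg n 2) : step (mirror M) c.mirror = (step M c).mirror := by
  obtain ⟨_ | q, p, a⟩ := c
  · rfl
  · simp only [step, Cfg.mirror, mirror, neg_neg, Dir.move_flip, Cfg.mk.injEq, true_and]
    refine ⟨by ring, funext fun j => ?_⟩
    by_cases h : j = -p
    · simp [h]
    · rw [Function.update_of_ne h, Function.update_of_ne (by omega)]

theorem iterate_step_mirror (i : ℕ) :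
    (step (mirror M))^[i] (init n 2) = ((step M)^[i] (init n 2)).mirror := by
  induction i with
  | zero => simp [init, Cfg.mirror]
  | succ i ih => rw [iterate_step_succ, iterate_step_succ, ih, step_mirror]

theorem headPos_mirror : headPos (mirror M) = fun i => -headPos M i := by
  funext i
  rw [headPos, iterate_step_mirror]
  rfl

theorem card_blanks_mirror (a : ℤ → Fin 2) (x y : ℤ) :
    (blanks (fun j => a (-j)) (Finset.Ioo (-y) (-x))).card = (blanks a (Finset.Ioo x y)).card := by
  refine Finset.card_nbij' (fun j => -j) (fun j => -j) ?_ ?_ ?_ ?_ <;>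
    intro j <;> simp [mem_blanks] <;> omega

/-- The score obtained by simulating `M`. -/
theorem le_bbSigma_of_iterate {u K : ℕ} {q : Fin n} {p : ℤ} {a : ℤ → Fin 2}
    (hu : (step M)^[u] (init n 2) = ⟨some q, p, a⟩) (hq : (M q (a p)).2.2 = none)
    (hK : 2 * runMin (headPos M) u + K + 1 = 2 * runMax (headPos M) u) :
    3 * 2 ^ K ≤ bbSigma (3 * n + 6) 2 := by
  rcases le_total (blanks a (Finset.Ioo p (runMax (headPos M) u))).card
    (blanks a (Finset.Ioo (runMin (headPos M) u) p)).card with h | h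
  · exact le_bbSigma_of_card_blanks_le hu hq hK h
  · have hmin : runMin (headPos (mirror M)) u = -runMax (headPos M) u := by
      rw [headPos_mirror, runMax, neg_neg]
    have hmax : runMax (headPos (mirror M)) u = -runMin (headPos M) u := by
      simp only [headPos_mirror, runMax, neg_neg]
    have hu' := iterate_step_mirror (M := M) u
    rw [hu] at hu'
    refine le_bbSigma_of_card_blanks_le hu' ?_ (by rw [hmin, hmax]; omega) ?_
    · simpa [mirror] using hq
    · rw [hmin, hmax, card_blanks_mirror, card_blanks_mirror]
      exact h

theorem HaltsIn.injective {t i k : ℕ} (h : HaltsIn M (init n 2) t) (hi : i < t) (hk : k < t)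
    (hik : (step M)^[i] (init n 2) = (step M)^[k] (init n 2)) : i = k := by
  wlog hlt : i < k generalizing i k
  · rcases (not_lt.1 hlt).lt_or_eq with h' | h'
    · exact (this hk hi hik.symm h').symm
    · exact h'.symm
  · refine absurd ?_ (h.2 (t - k + i) (by omega))
    rw [Function.iterate_add_apply, hik, ← Function.iterate_add_apply, Nat.sub_add_cancel hk.le]
    exact h.1

theorem Cfg.ext {c c' : Cfg n 2} (hstate : c.state = c'.state) (hpos : c.pos = c'.pos)
    (htape : c.tape = c'.tape) : c = c' := by
  cases c
  cases c'
  simp_all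

/-- The number of steps is bounded by the number of configurations in the space used. -/
theorem HaltsIn.le_of_space {u s : ℕ} (h : HaltsIn M (init n 2) (u + 1))
    (hs : runMin (headPos M) u + s = runMax (headPos M) u) :
    u + 1 ≤ n * (s + 1) * 2 ^ (s + 1) := by
  set I := Finset.Icc (runMin (headPos M) u) (runMax (headPos M) u) with hI
  have hIcard : Fintype.card I = s + 1 := by
    rw [Fintype.card_coe, Int.card_Icc]
    omega
  have hpos (i : Fin (u + 1)) : headPos M i ∈ I :=
    Finset.mem_Icc.2 ⟨runMin_le _ (by omega), le_runMax _ (by omega)⟩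
  have hstate (i : Fin (u + 1)) := Option.isSome_iff_ne_none.2 (h.2 i i.2)
  let F (i : Fin (u + 1)) : (Fin n × I) × (I → Fin 2) :=
    ((((step M)^[i] (init n 2)).state.get (hstate i), ⟨headPos M i, hpos i⟩),
      fun j => ((step M)^[i] (init n 2)).tape j)
  have hF : Function.Injective F := by
    intro i k hik
    simp only [F, Prod.mk.injEq, Subtype.mk.injEq, funext_iff, Subtype.forall] at hik
    obtain ⟨⟨h1, h2⟩, h3⟩ := hik
    have htape : ((step M)^[i] (init n 2)).tape = ((step M)^[k] (init n 2)).tape := by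
      funext j
      rcases lt_or_ge j (runMin (headPos M) u) with hj | hj
      · rw [tape_eq_zero_of_lt M (by omega) hj, tape_eq_zero_of_lt M (by omega) hj]
      · rcases lt_or_ge (runMax (headPos M) u) j with hj' | hj'
        · rw [tape_eq_zero_of_gt M (by omega) hj', tape_eq_zero_of_gt M (by omega) hj']
        · exact h3 j (Finset.mem_Icc.2 ⟨hj, hj'⟩)
    exact Fin.ext (h.injective i.2 k.2 (Cfg.ext (Option.get_inj.1 h1) h2 htape))
  have := Fintype.card_le_of_injective F hF
  rwa [Fintype.card_prod, Fintype.card_prod, Fintype.card_fun, hIcard, Fintype.card_fin,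
    Fintype.card_fin, Fintype.card_fin] at this

/-- A machine with a single state that halts does so in the first step. -/
theorem HaltsIn.le_one {M : Machine 1 2} {t : ℕ} (h : HaltsIn M (init 1 2) t) : t ≤ 1 := by
  by_contra! ht
  have hne : (M 0 0).2.2 ≠ none := h.2 1 ht
  have h0 : (M 0 0).2.2 = some 0 := by
    obtain ⟨q, hq⟩ := Option.ne_none_iff_exists'.1 hne
    rw [hq, Subsingleton.elim q 0]
  have hrun (i : ℕ) : ((step M)^[i] (init 1 2)).state = some 0 ∧
      ∀ j, 0 ≤ (j - ((step M)^[i] (init 1 2)).pos) * (M 0 0).2.1.move →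
        ((step M)^[i] (init 1 2)).tape j = 0 := by
    induction i with
    | zero => exact ⟨rfl, fun _ _ => rfl⟩
    | succ i ih =>
      rw [iterate_step_succ]
      rcases hc : (step M)^[i] (init 1 2) with ⟨o, p, a⟩
      rw [hc] at ih
      obtain ⟨rfl, ha⟩ := ih
      have hp : a p = 0 := ha p (by simp)
      simp only [step, hp] at ha ⊢
      refine ⟨h0, fun j hj => ?_⟩
      have hd : (M 0 0).2.1.move = 1 ∨ (M 0 0).2.1.move = -1 := by
        cases (M 0 0).2.1 <;> simp [Dir.move]
      rw [Function.update_of_ne, ha]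
      · rcases hd with hd | hd <;> rw [hd] at hj ⊢ <;> omega
      · rcases hd with hd | hd <;> rw [hd] at hj <;> omega
  have := h.1
  rw [(hrun t).1] at this
  exact absurd this (by simp)

end Run

theorem two_mul_mul_succ_lt_three_mul_two_pow {s : ℕ} (hs : 4 ≤ s) :
    2 * s * (s + 1) < 3 * 2 ^ s := by
  induction s, hs using Nat.le_induction with
  | base => norm_num
  | succ s hs ih =>
    rw [pow_succ]
    nlinarith

theorem thirtyTwo_mul_pow_four_lt {n : ℕ} (hn : 2 ≤ n) : 32 * n ^ 4 < 9 * 2 ^ (3 * n) := by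
  rw [pow_mul]
  induction n, hn using Nat.le_induction with
  | base => norm_num
  | succ n hn ih =>
    have h : (n + 1) ^ 4 ≤ 8 * n ^ 4 := by
      calc (n + 1) ^ 4 = ((n + 1) ^ 2) ^ 2 := by ring
        _ ≤ (8 * n ^ 4) := by
          have : 4 * (n + 1) ^ 2 ≤ 9 * n ^ 2 := by nlinarith
          have := Nat.pow_le_pow_left this 2
          nlinarith [Nat.zero_le (n ^ 4)]
    rw [pow_succ (2 ^ 3)]
    omega

theorem lt_of_space_bound {n s t B : ℕ} (hn : 2 ≤ n) (ht : t ≤ n * (s + 1) * 2 ^ (s + 1))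
    (hB : 3 * 2 ^ (3 * n) ≤ B) (hB' : ∀ k, s = k + 1 → 3 * 2 ^ (2 * k + 1) ≤ B) : t < B := by
  rcases lt_or_ge (4 * n * (s + 1)) (3 * 2 ^ s) with h | h
  · obtain _ | k := s
    · omega
    · refine lt_of_lt_of_le ?_ (hB' k rfl)
      have hpos : 0 < 2 ^ k := by positivity
      rw [show 2 ^ (2 * k + 1) = 2 * (2 ^ k * 2 ^ k) by ring]
      rw [pow_succ] at h
      rw [show 2 ^ (k + 1 + 1) = 4 * 2 ^ k by ring] at ht
      nlinarith
  · have hs : s + 1 ≤ 2 * n := by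
      by_contra! hs
      have := two_mul_mul_succ_lt_three_mul_two_pow (s := s) (by omega)
      nlinarith
    refine lt_of_lt_of_le ?_ hB
    have h1 := thirtyTwo_mul_pow_four_lt hn
    have h2 : 3 * t ≤ 8 * (n * (s + 1)) ^ 2 := by
      calc 3 * t ≤ 2 * (n * (s + 1)) * (3 * 2 ^ s) := by
            rw [pow_succ] at ht
            nlinarith
        _ ≤ 2 * (n * (s + 1)) * (4 * n * (s + 1)) := Nat.mul_le_mul_left _ h
        _ = _ := by ring
    have h3 : (n * (s + 1)) ^ 2 ≤ (n * (2 * n)) ^ 2 :=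
      Nat.pow_le_pow_left (Nat.mul_le_mul_left _ hs) 2
    have h4 : (n * (2 * n)) ^ 2 = 4 * n ^ 4 := by ring
    omega

theorem HaltsIn.lt_bbSigma {n t : ℕ} {M : Machine n 2} (hn : 1 ≤ n)
    (h : HaltsIn M (init n 2) t) : t < bbSigma (3 * n + 6) 2 := by
  have hB := three_mul_two_pow_le_bbSigma hn
  rcases hn.eq_or_lt with rfl | hn
  · have := h.le_one
    omega
  obtain _ | u := t
  · exact lt_of_lt_of_le (by positivity) hB
  obtain ⟨s, hs⟩ : ∃ s : ℕ, runMin (headPos M) u + s = runMax (headPos M) u :=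
    ⟨(runMax (headPos M) u - runMin (headPos M) u).toNat, by
      have := (runMin_le (headPos M) le_rfl).trans (le_runMax (headPos M) (le_refl u))
      omega⟩
  refine lt_of_space_bound hn (h.le_of_space hs) hB fun k hk => ?_
  rcases hu : (step M)^[u] (init n 2) with ⟨_ | q, p, a⟩
  · exact absurd (by rw [hu]) (h.2 u (by omega))
  · refine le_bbSigma_of_iterate hu ?_ (by push_cast; omega)
    simpa [iterate_step_succ, hu, step] using h.1

/-- Ben-Amram, Julstrom and Zwick's bound: for every `n ≥ 1`, `S(n,2) < Σ(3n+6, 2)`. -/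
theorem S_lt_Sigma_three_n_add_six (n : ℕ) (hn : 1 ≤ n) :
    bbS n 2 < bbSigma (3 * n + 6) 2 := by
  have hpos : 0 < bbSigma (3 * n + 6) 2 :=
    lt_of_lt_of_le (by positivity) (three_mul_two_pow_le_bbSigma hn)
  refine lt_of_le_of_lt (csSup_le' ?_) (Nat.sub_one_lt hpos.ne')
  rintro t ⟨M, -, ht⟩
  exact Nat.le_sub_one_of_lt (ht.lt_bbSigma hn)
end
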